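/- (Inversion of the SQFT.) If f ∈ L¹(ℝ²,ℍ) and ℱ_s f ∈ L¹(ℝ²,ℍ), then f(x₁,x₂) = (1/(2π)) ∫_{ℝ²} e^{i ω₁ x₁} (ℱ_s f)(ω₁,ω₂) e^{j ω₂ x₂} dω₁ dω₂ for almost every (x₁,x₂) ∈ ℝ². -/

import Mathlib

open MeasureTheory Real ENNReal

noncomputable section

/-- The real quaternions. -/
abbrev Hq := Quaternion ℝ

/-- The imaginary unit `i`. -/
def qi : Hq := ⟨0,1,0,0⟩
/-- The imaginary unit `j`. -/
def qj : Hq := ⟨0,0,1,0⟩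
/-- The imaginary unit `k`. -/
def qk : Hq := ⟨0,0,0,1⟩

/-- For a (unit pure imaginary) quaternion `u`, `e^{uθ} := cos θ + u sin θ`. -/
def qexp (u : Hq) (θ : ℝ) : Hq := (Real.cos θ) • (1 : Hq) + (Real.sin θ) • u

/-- The right-sided quaternion Fourier transform of `f ∈ L¹(ℝ²,ℍ)`. -/
def Fr (f : ℝ × ℝ → Hq) (ω : ℝ × ℝ) : Hq :=
  (1 / (2 * Real.pi)) • ∫ x : ℝ × ℝ, f x * qexp qi (-(ω.1 * x.1)) * qexp qj (-(ω.2 * x.2))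

/-- The two-sided quaternion Fourier transform of `f ∈ L¹(ℝ²,ℍ)`. -/
def Fs (f : ℝ × ℝ → Hq) (ω : ℝ × ℝ) : Hq :=
  (1 / (2 * Real.pi)) • ∫ x : ℝ × ℝ, qexp qi (-(ω.1 * x.1)) * f x * qexp qj (-(ω.2 * x.2))



open scoped FourierTransform RealInnerProductSpace ContDiff in
/-- Almost everywhere Fourier inversion. -/
theorem ae_fourier_inversion {V : Type*} [NormedAddCommGroup V] [InnerProductSpace ℝ V]
    [MeasurableSpace V] [BorelSpace V] [FiniteDimensional ℝ V] {f : V → ℂ}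
    (hf : Integrable f) (hf2 : Integrable (𝓕 f)) : ∀ᵐ x, f x = 𝓕⁻ (𝓕 f) x := by
  have hcont : Continuous (𝓕⁻ (𝓕 f)) :=
    VectorFourier.fourierIntegral_continuous Real.continuous_fourierChar
      (L := -innerₗ V) (by simpa using! continuous_inner.neg) hf2
  apply ae_eq_of_integral_contDiff_smul_eq hf.locallyIntegrable hcont.locallyIntegrable
  intro g hg hgc
  have hgc' : HasCompactSupport (fun x => (g x : ℂ)) :=
    hgc.comp_left (g := fun r : ℝ => (r : ℂ)) (by simp)
  have hg' : ContDiff ℝ ∞ (fun x => (g x : ℂ)) := Complex.ofRealCLM.contDiff.comp hg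
  let φ : SchwartzMap V ℂ := hgc'.toSchwartzMap hg'
  let ψ : SchwartzMap V ℂ := 𝓕⁻ φ
  have hψ : (ψ : V → ℂ) = 𝓕⁻ (φ : V → ℂ) := SchwartzMap.fourierInv_coe φ
  have h1 : 𝓕 (ψ : V → ℂ) = (φ : V → ℂ) := by
    rw [← SchwartzMap.fourier_coe]
    congr 1
    exact FourierTransform.fourier_fourierInv_eq φ
  have e1 : ∫ x, 𝓕 (ψ : V → ℂ) x • f x = ∫ x, ψ x • 𝓕 f x := by
    simpa using! (VectorFourier.integral_fourierIntegral_smul_eq_flip (L := innerₗ V)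
      Real.continuous_fourierChar continuous_inner ψ.integrable hf)
  have e2 : ∫ x, 𝓕⁻ (φ : V → ℂ) x • 𝓕 f x = ∫ x, φ x • 𝓕⁻ (𝓕 f) x := by
    have := (VectorFourier.integral_fourierIntegral_smul_eq_flip (L := -innerₗ V)
      (μ := volume) (ν := volume)
      Real.continuous_fourierChar (by simpa using! continuous_inner.neg) φ.integrable hf2)
    have hflip : (-innerₗ V).flip = -innerₗ V := by
      ext x y; simp [real_inner_comm]
    rw [hflip] at this
    exact this
  rw [h1, hψ, e2] at e1
  simpa [φ] using e1

theorem scalar_inv (g : ℝ × ℝ → ℂ) (hg : Integrable g)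
    (hS : Integrable (fun ω : ℝ × ℝ =>
      ∫ x : ℝ × ℝ, Complex.exp (((-(ω.1 * x.1 + ω.2 * x.2) : ℝ) : ℂ) * Complex.I) * g x)) :
    ∀ᵐ x : ℝ × ℝ, g x = (((2 * π) ^ 2)⁻¹ : ℝ) • ∫ ω : ℝ × ℝ,
      Complex.exp (((ω.1 * x.1 + ω.2 * x.2 : ℝ) : ℂ) * Complex.I) *
      ∫ x : ℝ × ℝ, Complex.exp (((-(ω.1 * x.1 + ω.2 * x.2) : ℝ) : ℂ) * Complex.I) * g x := by
  set S : ℝ × ℝ → ℂ := fun ω => ∫ x : ℝ × ℝ,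
    Complex.exp (((-(ω.1 * x.1 + ω.2 * x.2) : ℝ) : ℂ) * Complex.I) * g x with hSdef
  have mp := WithLp.volume_preserving_ofLp ℝ ℝ
  have me : MeasurableEmbedding (@WithLp.ofLp 2 (ℝ × ℝ)) :=
    (MeasurableEquiv.toLp 2 (ℝ × ℝ)).symm.measurableEmbedding
  let G : WithLp 2 (ℝ × ℝ) → ℂ := fun v => g (WithLp.ofLp v)
  have hG : Integrable G := (mp.integrable_comp_emb me).2 hg
  have hFG : ∀ w, FourierTransform.fourier G w = S ((2 * π) • WithLp.ofLp w) := by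
    intro w
    rw [Real.fourier_eq', hSdef]
    simp only
    rw [← mp.integral_comp me]
    congr 1
    ext v
    simp only [smul_eq_mul, G, WithLp.prod_inner_apply]
    congr 4
    simp
    ring
  have hFG' : FourierTransform.fourier G =
    (fun ω : ℝ × ℝ => S ((2 * π) • ω)) ∘ (@WithLp.ofLp 2 (ℝ × ℝ)) := funext hFG
  have hpi : (2 * π) ≠ 0 := by positivity
  have hI : Integrable (FourierTransform.fourier G) := by
    rw [hFG', mp.integrable_comp_emb me]
    exact hS.comp_smul hpi
  have key := ae_fourier_inversion hG hI
  have mp' := WithLp.volume_preserving_toLp ℝ ℝ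
  have key2 := mp'.quasiMeasurePreserving.ae key
  filter_upwards [key2] with x hx
  have : g x = G (WithLp.toLp 2 x) := rfl
  rw [this, hx, Real.fourierInv_eq', hFG']
  have e := Measure.integral_comp_smul (volume : Measure (ℝ × ℝ)) (fun ω : ℝ × ℝ =>
    Complex.exp (((ω.1 * x.1 + ω.2 * x.2 : ℝ) : ℂ) * Complex.I) * S ω) (2 * π)
  have hfr : Module.finrank ℝ (ℝ × ℝ) = 2 := by simp
  rw [hfr, abs_of_nonneg (by positivity)] at e
  rw [← e, ← mp.integral_comp me]
  congr 1
  ext v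
  simp only [smul_eq_mul, WithLp.prod_inner_apply, Function.comp]
  congr 4
  simp
  ring

theorem scalar_inv_neg (g : ℝ × ℝ → ℂ) (hg : Integrable g)
    (hS : Integrable (fun ω : ℝ × ℝ =>
      ∫ x : ℝ × ℝ, Complex.exp (((-(ω.1 * x.1 - ω.2 * x.2) : ℝ) : ℂ) * Complex.I) * g x)) :
    ∀ᵐ x : ℝ × ℝ, g x = (((2 * π) ^ 2)⁻¹ : ℝ) • ∫ ω : ℝ × ℝ,
      Complex.exp (((ω.1 * x.1 - ω.2 * x.2 : ℝ) : ℂ) * Complex.I) *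
      ∫ x : ℝ × ℝ, Complex.exp (((-(ω.1 * x.1 - ω.2 * x.2) : ℝ) : ℂ) * Complex.I) * g x := by
  have mp : MeasurePreserving (Prod.map id Neg.neg : ℝ × ℝ → ℝ × ℝ) :=
    (MeasurePreserving.id volume).prod (Measure.measurePreserving_neg volume)
  have me : MeasurableEmbedding (Prod.map id Neg.neg : ℝ × ℝ → ℝ × ℝ) :=
    ((MeasurableEquiv.refl ℝ).prodCongr (MeasurableEquiv.neg ℝ)).measurableEmbedding
  have hS' := (mp.integrable_comp_emb me).2 hS
  have key := scalar_inv g hg (by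
    simpa [Function.comp_def, sub_eq_add_neg] using hS')
  filter_upwards [key] with x hx
  refine hx.trans ?_
  congr 1
  rw [← mp.integral_comp me]
  simp [sub_eq_add_neg]

/-- The complex-valued functionals `α + β j ↦ α + s β I` diagonalising left multiplication
by `i` and right multiplication by `j`. -/
def Afun (s : ℝ) : Hq →ₗ[ℝ] ℂ where
  toFun q := ⟨q.re - s * q.imK, q.imI + s * q.imJ⟩
  map_add' p q := by apply Complex.ext <;> simp <;> ring
  map_smul' r q := by apply Complex.ext <;> simp <;> ring

def Acl (s : ℝ) : Hq →L[ℝ] ℂ := LinearMap.toContinuousLinearMap (Afun s)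

theorem Acl_apply (s : ℝ) (q : Hq) :
    Acl s q = ⟨q.re - s * q.imK, q.imI + s * q.imJ⟩ := rfl

theorem qi_re (a : ℝ) : (qexp qi a).re = Real.cos a := by
  have h : (qexp qi a).re = Real.cos a * 1 + Real.sin a * 0 := rfl
  rw [h]; ring

theorem qi_imI (a : ℝ) : (qexp qi a).imI = Real.sin a := by
  have h : (qexp qi a).imI = Real.cos a * 0 + Real.sin a * 1 := rfl
  rw [h]; ring

theorem qi_imJ (a : ℝ) : (qexp qi a).imJ = 0 := by
  have h : (qexp qi a).imJ = Real.cos a * 0 + Real.sin a * 0 := rfl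
  rw [h]; ring

theorem qi_imK (a : ℝ) : (qexp qi a).imK = 0 := by
  have h : (qexp qi a).imK = Real.cos a * 0 + Real.sin a * 0 := rfl
  rw [h]; ring

theorem qj_re (a : ℝ) : (qexp qj a).re = Real.cos a := by
  have h : (qexp qj a).re = Real.cos a * 1 + Real.sin a * 0 := rfl
  rw [h]; ring

theorem qj_imI (a : ℝ) : (qexp qj a).imI = 0 := by
  have h : (qexp qj a).imI = Real.cos a * 0 + Real.sin a * 0 := rfl
  rw [h]; ring

theorem qj_imJ (a : ℝ) : (qexp qj a).imJ = Real.sin a := by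
  have h : (qexp qj a).imJ = Real.cos a * 0 + Real.sin a * 1 := rfl
  rw [h]; ring

theorem qj_imK (a : ℝ) : (qexp qj a).imK = 0 := by
  have h : (qexp qj a).imK = Real.cos a * 0 + Real.sin a * 0 := rfl
  rw [h]; ring

theorem Acl_qexp (s : ℝ) (hs : s * s = 1) (q : Hq) (a b : ℝ) :
    Acl s (qexp qi a * q * qexp qj b) =
      Complex.exp (((a + s * b : ℝ) : ℂ) * Complex.I) * Acl s q := by
  have hc : Real.cos (a + s * b) = Real.cos a * Real.cos b - s * (Real.sin a * Real.sin b) := by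
    rcases mul_self_eq_one_iff.1 hs with rfl | rfl <;> simp [Real.cos_add]
  have hn : Real.sin (a + s * b) = Real.sin a * Real.cos b + s * (Real.cos a * Real.sin b) := by
    rcases mul_self_eq_one_iff.1 hs with rfl | rfl <;> simp [Real.sin_add]
  rw [Complex.exp_mul_I, ← Complex.ofReal_cos, ← Complex.ofReal_sin, hc, hn]
  simp only [Acl_apply, Quaternion.re_mul, Quaternion.imI_mul, Quaternion.imJ_mul,
    Quaternion.imK_mul, qi_re, qi_imI, qi_imJ, qi_imK, qj_re, qj_imI, qj_imJ, qj_imK]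
  generalize Real.cos a = ca
  generalize Real.cos b = cb
  generalize Real.sin a = sa
  generalize Real.sin b = sb
  apply Complex.ext
  · simp
    linear_combination (ca * sb * q.imJ - sa * sb * q.imK) * hs
  · simp
    linear_combination (ca * sb * q.imK + sa * sb * q.imJ) * hs

theorem qexp_continuous (u : Hq) : Continuous (qexp u) := by
  unfold qexp; fun_prop

theorem qexp_norm_le (u : Hq) (θ : ℝ) : ‖qexp u θ‖ ≤ 1 + ‖u‖ := by
  unfold qexp
  refine (norm_add_le _ _).trans ?_
  rw [norm_smul, norm_smul, norm_one, mul_one]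
  have h1 : ‖Real.cos θ‖ ≤ 1 := Real.abs_cos_le_one θ
  have h2 : ‖Real.sin θ‖ ≤ 1 := Real.abs_sin_le_one θ
  nlinarith [norm_nonneg u]

theorem kernel_integrable {f : ℝ × ℝ → Hq} (hf : Integrable f) (a b : ℝ × ℝ → ℝ)
    (ha : Continuous a) (hb : Continuous b) :
    Integrable (fun x => qexp qi (a x) * f x * qexp qj (b x)) := by
  have h1 : Integrable (fun x => qexp qi (a x) * f x) :=
    hf.bdd_mul ((qexp_continuous qi).comp ha).aestronglyMeasurable
      (Filter.Eventually.of_forall fun x => qexp_norm_le _ _)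
  exact h1.mul_bdd (c := 1 + ‖qj‖) ((qexp_continuous qj).comp hb).aestronglyMeasurable
      (Filter.Eventually.of_forall fun x => qexp_norm_le _ _)

theorem Acl_Fs (s : ℝ) (hs : s * s = 1) {f : ℝ × ℝ → Hq} (hf : Integrable f) (ω : ℝ × ℝ) :
    Acl s (Fs f ω) = (1 / (2 * π)) • ∫ x : ℝ × ℝ,
      Complex.exp (((-(ω.1 * x.1 + s * (ω.2 * x.2)) : ℝ) : ℂ) * Complex.I) * Acl s (f x) := by
  rw [Fs, map_smul, ← ContinuousLinearMap.integral_comp_comm _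
    (kernel_integrable hf _ _ (by fun_prop) (by fun_prop))]
  congr 2
  ext x
  rw [Acl_qexp s hs]
  congr 4
  ring

theorem Acl_inv (s : ℝ) (hs : s * s = 1) {f : ℝ × ℝ → Hq} (hf : Integrable f)
    (hFf : Integrable (Fs f)) :
    ∀ᵐ x : ℝ × ℝ, Acl s (f x) = Acl s ((1 / (2 * Real.pi)) •
        ∫ ω : ℝ × ℝ, qexp qi (ω.1 * x.1) * Fs f ω * qexp qj (ω.2 * x.2)) := by
  have hpi : (2 * π) ≠ 0 := by positivity
  have hg : Integrable (fun x => Acl s (f x)) := (Acl s).integrable_comp hf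
  have hS : Integrable (fun ω : ℝ × ℝ => ∫ x : ℝ × ℝ,
      Complex.exp (((-(ω.1 * x.1 + s * (ω.2 * x.2)) : ℝ) : ℂ) * Complex.I) * Acl s (f x)) := by
    have h := ((Acl s).integrable_comp hFf).smul (2 * π)
    refine h.congr (Filter.Eventually.of_forall fun ω => ?_)
    simp only [Pi.smul_apply, Acl_Fs s hs hf, smul_smul]
    rw [mul_one_div_cancel hpi, one_smul]
  have key : ∀ᵐ x : ℝ × ℝ, Acl s (f x) = (((2 * π) ^ 2)⁻¹ : ℝ) • ∫ ω : ℝ × ℝ,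
      Complex.exp (((ω.1 * x.1 + s * (ω.2 * x.2) : ℝ) : ℂ) * Complex.I) *
      ∫ x : ℝ × ℝ, Complex.exp (((-(ω.1 * x.1 + s * (ω.2 * x.2)) : ℝ) : ℂ) * Complex.I)
        * Acl s (f x) := by
    rcases mul_self_eq_one_iff.1 hs with rfl | rfl
    · simp only [one_mul] at hS ⊢
      exact scalar_inv _ hg hS
    · simp only [neg_one_mul, ← sub_eq_add_neg] at hS ⊢
      exact scalar_inv_neg _ hg hS
  filter_upwards [key] with x hx
  rw [hx, map_smul, ← ContinuousLinearMap.integral_comp_comm _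
    (kernel_integrable hFf _ _ (by fun_prop) (by fun_prop))]
  simp only [Acl_qexp s hs, Acl_Fs s hs hf, mul_smul_comm]
  rw [integral_smul, smul_smul]
  congr 1
  field_simp

theorem Acl_injective {p q : Hq} (h1 : Acl 1 p = Acl 1 q) (h2 : Acl (-1) p = Acl (-1) q) :
    p = q := by
  simp only [Acl_apply, Complex.mk.injEq] at h1 h2
  obtain ⟨a, b⟩ := h1
  obtain ⟨c, d⟩ := h2
  ext <;> linarith

theorem stmt11 (f : ℝ × ℝ → Hq) (hf : Integrable f) (hFf : Integrable (Fs f)) :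
    ∀ᵐ x : ℝ × ℝ, f x =
      (1 / (2 * Real.pi)) •
        ∫ ω : ℝ × ℝ, qexp qi (ω.1 * x.1) * Fs f ω * qexp qj (ω.2 * x.2) := by
  filter_upwards [Acl_inv 1 (by norm_num) hf hFf, Acl_inv (-1) (by norm_num) hf hFf] with x h1 h2
  exact Acl_injective h1 h2
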